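/- Fix q ∈ (0,1), β ∈ [0,∞), γ ∈ (0,∞), ζ ∈ (0, (min{q,1−q})^{1/(β+1)}/γ), and τ ∈ (0, min{q,1−q} − (γζ)^{β+1}]. Let F be the CDF of a (β,γ,ζ)-clustered probability distribution on [0,∞) with finite mean satisfying F(a*−ζ) ≥ τ and F(a*+ζ) ≤ 1−τ, and let â be the SAA decision based on n IID samples from F. Then for every number of samples n ≥ 1, the expected multiplicative regret satisfies (E[L(â)] − L(a*))/L(a*) ≤ max{ 1/(n·(γζ)^{β+1}·min{q,1−q}), (2/(γζτ))·(1/(β+1) + 1/√e)·(1/(2√n))^{(β+2)/(β+1)} }. -/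

import Mathlib

open MeasureTheory Set

noncomputable section

/-- The Newsvendor loss `ℓ(a,Z) = q·max{Z−a,0} + (1−q)·max{a−Z,0}` with critical quantile `q`. -/
def nvLoss (q a z : ℝ) : ℝ := q * max (z - a) 0 + (1 - q) * max (a - z) 0

/-- The expected Newsvendor loss `L(a)` under the demand distribution `μ`. -/
def expLoss (q : ℝ) (μ : Measure ℝ) (a : ℝ) : ℝ := ∫ z, nvLoss q a z ∂μ

/-- The CDF of the demand distribution `μ`. -/
def cdf' (μ : Measure ℝ) (z : ℝ) : ℝ := (μ (Iic z)).toReal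

/-- The optimal decision `a* = inf {a ≥ 0 : F(a) ≥ q}`. -/
def optDec (q : ℝ) (μ : Measure ℝ) : ℝ := sInf {a : ℝ | 0 ≤ a ∧ q ≤ cdf' μ a}

/-- The empirical CDF of the samples `ω : Fin n → ℝ`. -/
def empCdf (n : ℕ) (ω : Fin n → ℝ) (z : ℝ) : ℝ :=
  (∑ i : Fin n, if ω i ≤ z then (1 : ℝ) else 0) / n

/-- The SAA (sample average approximation) decision `â = inf {a ≥ 0 : F̂(a) ≥ q}`. -/
def saa (q : ℝ) (n : ℕ) (ω : Fin n → ℝ) : ℝ := sInf {a : ℝ | 0 ≤ a ∧ q ≤ empCdf n ω a}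

/-- The joint law of `n` iid samples from `μ`. -/
def iid (μ : Measure ℝ) (n : ℕ) : Measure (Fin n → ℝ) := Measure.pi fun _ => μ

/-- A distribution `μ` is `(β,γ,ζ)`-clustered if
`|a − a*| ≤ (1/γ)·|F(a) − q|^{1/(β+1)}` for all `a ∈ [a*−ζ, a*+ζ]`. -/
def Clustered (q β γ ζ : ℝ) (μ : Measure ℝ) : Prop :=
  ∀ a ∈ Icc (optDec q μ - ζ) (optDec q μ + ζ),
    |a - optDec q μ| ≤ (1 / γ) * |cdf' μ a - q| ^ ((1 : ℝ) / (β + 1))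

open ProbabilityTheory in
/-- Hoeffding's inequality for the number of samples falling in a set. -/
theorem iid_count_ge_le_exp (μ : Measure ℝ) [IsProbabilityMeasure μ] {n : ℕ} (hn : 1 ≤ n)
    {A : Set ℝ} (hA : MeasurableSet A) {r : ℝ} (hr : μ.real A ≤ r) :
    (iid μ n).real {ω | n * r ≤ ∑ i, A.indicator 1 (ω i)}
      ≤ Real.exp (-2 * n * (r - μ.real A) ^ 2) := by
  have hm : Measurable (A.indicator (1 : ℝ → ℝ)) := measurable_one.indicator hA
  have hI : μ[A.indicator (1 : ℝ → ℝ)] = μ.real A := integral_indicator_one hA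
  have hsub : HasSubgaussianMGF (fun x ↦ A.indicator (1 : ℝ → ℝ) x - μ.real A)
      ((‖(1 : ℝ) - 0‖₊ / 2) ^ 2) μ := by
    rw [← hI]
    refine hasSubgaussianMGF_of_mem_Icc hm.aemeasurable (ae_of_all _ fun x ↦ ?_)
    by_cases hx : x ∈ A <;> simp [hx]
  have hind : iIndepFun (fun (i : Fin n) (ω : Fin n → ℝ) ↦ A.indicator (1 : ℝ → ℝ) (ω i) - μ.real A)
      (iid μ n) :=
    iIndepFun_pi (X := fun _ x ↦ A.indicator (1 : ℝ → ℝ) x - μ.real A)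
      fun _ ↦ (hm.sub_const _).aemeasurable
  have hsub' : ∀ i ∈ (Finset.univ : Finset (Fin n)),
      HasSubgaussianMGF (fun ω : Fin n → ℝ ↦ A.indicator (1 : ℝ → ℝ) (ω i) - μ.real A)
        ((‖(1 : ℝ) - 0‖₊ / 2) ^ 2) (iid μ n) := by
    intro i _
    refine HasSubgaussianMGF.of_map (Y := fun ω : Fin n → ℝ ↦ ω i)
      (X := fun x ↦ A.indicator (1 : ℝ → ℝ) x - μ.real A) (measurable_pi_apply i).aemeasurable ?_
    rw [iid, (measurePreserving_eval (fun _ ↦ μ) i).map_eq]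
    exact hsub
  have hn' : (0 : ℝ) < n := by positivity
  have key := HasSubgaussianMGF.measure_sum_ge_le_of_iIndepFun hind hsub'
    (ε := n * (r - μ.real A)) (mul_nonneg hn'.le (sub_nonneg.2 hr))
  convert! key using 2
  · ext ω
    simp [Finset.sum_sub_distrib, mul_sub]
  · simp
    field_simp

open ProbabilityTheory in
/-- Chebyshev's inequality for the number of samples falling in a set. -/
theorem iid_count_ge_le_variance (μ : Measure ℝ) [IsProbabilityMeasure μ] {n : ℕ} (hn : 1 ≤ n)
    {A : Set ℝ} (hA : MeasurableSet A) {r : ℝ} (hr : μ.real A < r) :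
    (iid μ n).real {ω | n * r ≤ ∑ i, A.indicator 1 (ω i)}
      ≤ μ.real A * (1 - μ.real A) / (n * (r - μ.real A) ^ 2) := by
  have hprob : IsProbabilityMeasure (iid μ n) := by unfold iid; infer_instance
  have hm : Measurable (A.indicator (1 : ℝ → ℝ)) := measurable_one.indicator hA
  have hI : μ[A.indicator (1 : ℝ → ℝ)] = μ.real A := integral_indicator_one hA
  have hL : MemLp (A.indicator (1 : ℝ → ℝ)) 2 μ :=
    (memLp_const (1 : ℝ)).indicator hA
  have hLi : ∀ i, MemLp (fun ω : Fin n → ℝ ↦ A.indicator (1 : ℝ → ℝ) (ω i)) 2 (iid μ n) :=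
    fun i ↦ hL.comp_measurePreserving (measurePreserving_eval (fun _ ↦ μ) i)
  have hvar : Var[A.indicator (1 : ℝ → ℝ); μ] = μ.real A * (1 - μ.real A) := by
    rw [variance_eq_sub hL, hI]
    have : A.indicator (1 : ℝ → ℝ) ^ 2 = A.indicator 1 := by
      ext x; by_cases hx : x ∈ A <;> simp [hx]
    rw [this, hI]; ring
  have hVS : Var[∑ i, fun ω : Fin n → ℝ ↦ A.indicator (1 : ℝ → ℝ) (ω i); iid μ n]
      = n * (μ.real A * (1 - μ.real A)) := by
    rw [iid, variance_sum_pi (X := fun _ ↦ A.indicator (1 : ℝ → ℝ)) fun _ ↦ hL]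
    simp [hvar]
  have hES : (iid μ n)[∑ i, fun ω : Fin n → ℝ ↦ A.indicator (1 : ℝ → ℝ) (ω i)]
      = n * μ.real A := by
    simp only [Finset.sum_apply]
    rw [integral_finsetSum _ fun i _ ↦ (hLi i).integrable one_le_two]
    have (i : Fin n) : ∫ ω, A.indicator (1 : ℝ → ℝ) (ω i) ∂(iid μ n) = μ.real A := by
      rw [← hI, iid]
      exact integral_comp_eval (μ := fun _ : Fin n ↦ μ) hm.aestronglyMeasurable
    simp [this]
  have hn' : (0 : ℝ) < n := by positivity
  have hc : 0 < n * (r - μ.real A) := mul_pos hn' (sub_pos.2 hr)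
  have hp : 0 ≤ μ.real A * (1 - μ.real A) :=
    mul_nonneg measureReal_nonneg (sub_nonneg.2 measureReal_le_one)
  have key := meas_ge_le_variance_div_sq (memLp_finsetSum' Finset.univ fun i _ ↦ hLi i) hc
  rw [hVS, hES] at key
  refine ENNReal.toReal_le_of_le_ofReal (by positivity) ?_
  calc _ ≤ _ := measure_mono fun ω hω ↦ ?_
    _ ≤ _ := key
    _ = _ := by congr 1; field_simp
  simp only [mem_ofPred_eq, Finset.sum_apply] at hω ⊢
  rw [mul_sub]
  exact le_trans (by linarith) (le_abs_self _)

theorem mul_exp_neg_sq_le_of_rpow_le {p s w : ℝ} (hp : 1 ≤ p) (hw : 0 ≤ w) (hs : w ^ p ≤ s) :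
    s * Real.exp (-(s ^ 2 / 2)) ≤ (if w ≤ 1 then Real.exp (-(1 / 2)) else 0)
      + w ^ (2 * p - 1) * Real.exp (-(w ^ (2 * p) / 2)) := by
  have hk : 0 ≤ w ^ (2 * p - 1) * Real.exp (-(w ^ (2 * p) / 2)) := by positivity
  have hs0 : 0 ≤ s := (Real.rpow_nonneg hw p).trans hs
  split_ifs with h
  · have h1 : s ≤ Real.exp ((s ^ 2 - 1) / 2) :=
      le_trans (by nlinarith [sq_nonneg (s - 1)]) (Real.add_one_le_exp _)
    have h2 : s * Real.exp (-(s ^ 2 / 2)) ≤ Real.exp (-(1 / 2)) := by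
      refine (mul_le_mul_of_nonneg_right h1 (Real.exp_nonneg _)).trans ?_
      rw [← Real.exp_add]
      exact Real.exp_le_exp.2 (by linarith)
    linarith
  · rw [not_le] at h
    have hu : 1 ≤ w ^ p := Real.one_le_rpow h.le (by linarith)
    have hsq : w ^ (2 * p) = (w ^ p) ^ 2 := by
      rw [mul_comm, Real.rpow_mul hw]; norm_cast
    have hle : w ^ p ≤ w ^ (2 * p - 1) := Real.rpow_le_rpow_of_exponent_le h.le (by linarith)
    rw [hsq, zero_add]
    refine le_trans ?_ (mul_le_mul_of_nonneg_right hle (Real.exp_nonneg _))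
    set u := w ^ p
    have h1 : s ≤ u * Real.exp ((s ^ 2 - u ^ 2) / 2) := by
      have h3 := mul_le_mul_of_nonneg_left (Real.add_one_le_exp ((s ^ 2 - u ^ 2) / 2))
        (zero_le_one.trans hu)
      have h4 : 0 ≤ (s - u) * (u * (s + u) - 2) :=
        mul_nonneg (sub_nonneg.2 hs) (by nlinarith)
      nlinarith
    refine (mul_le_mul_of_nonneg_right h1 (Real.exp_nonneg _)).trans ?_
    rw [mul_assoc, ← Real.exp_add]
    exact (congrArg _ (congrArg _ (by ring))).le

theorem lintegral_mul_exp_neg_rpow_le {p t₀ ζ : ℝ} (hp : 1 ≤ p) (ht₀ : 0 < t₀) (hζ : 0 < ζ) :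
    ∫⁻ t in Ico 0 ζ, ENNReal.ofReal
      ((if t / t₀ ≤ 1 then Real.exp (-(1 / 2)) else 0)
        + (t / t₀) ^ (2 * p - 1) * Real.exp (-((t / t₀) ^ (2 * p) / 2)))
      ≤ ENNReal.ofReal (t₀ * (1 / p + Real.exp (-(1 / 2)))) := by
  set k : ℝ → ℝ := fun t ↦ (t / t₀) ^ (2 * p - 1) * Real.exp (-((t / t₀) ^ (2 * p) / 2)) with hk
  have hp0 : 0 < p := by linarith
  have hkc : Continuous k := by
    have h1 : Continuous fun t : ℝ ↦ (t / t₀) ^ (2 * p - 1) :=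
      (continuous_id.div_const _).rpow_const fun _ ↦ Or.inr (by linarith)
    have h2 : Continuous fun t : ℝ ↦ (t / t₀) ^ (2 * p) :=
      (continuous_id.div_const _).rpow_const fun _ ↦ Or.inr (by linarith)
    fun_prop
  have hk0 : ∀ t ∈ Ico 0 ζ, 0 ≤ k t := fun t ht ↦
    mul_nonneg (Real.rpow_nonneg (div_nonneg ht.1 ht₀.le) _) (Real.exp_nonneg _)
  have hderiv : ∀ t ∈ uIcc 0 ζ,
      HasDerivAt (fun t ↦ -(t₀ / p) * Real.exp (-((t / t₀) ^ (2 * p) / 2))) (k t) t := by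
    intro t _
    have h1 : HasDerivAt (fun t : ℝ ↦ t / t₀) (1 / t₀) t := (hasDerivAt_id t).div_const _
    have h2 := h1.rpow_const (p := 2 * p) (Or.inr (by linarith))
    convert! ((h2.div_const 2).neg.exp).const_mul (-(t₀ / p)) using 1
    simp only [hk, Pi.neg_apply]
    field_simp
  have hint : ∫ t in (0 : ℝ)..ζ, k t ≤ t₀ / p := by
    rw [intervalIntegral.integral_eq_sub_of_hasDerivAt hderiv (hkc.intervalIntegrable _ _)]
    have : (0 / t₀) ^ (2 * p) = 0 := by rw [zero_div, Real.zero_rpow (by linarith)]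
    rw [this]
    have : 0 ≤ t₀ / p * Real.exp (-((ζ / t₀) ^ (2 * p) / 2)) := by positivity
    simp
    linarith
  have hlint : ∫⁻ t in Ico 0 ζ, ENNReal.ofReal (k t) ≤ ENNReal.ofReal (t₀ / p) := by
    rw [← ofReal_integral_eq_lintegral_ofReal, integral_Ico_eq_integral_Ioc,
      ← intervalIntegral.integral_of_le hζ.le]
    · exact ENNReal.ofReal_le_ofReal hint
    · exact (hkc.integrableOn_Icc).mono_set Ico_subset_Icc_self
    · exact (ae_restrict_iff' measurableSet_Ico).2 (ae_of_all _ hk0)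
  have hconst : ∫⁻ t in Ico 0 ζ, ENNReal.ofReal (if t / t₀ ≤ 1 then Real.exp (-(1 / 2)) else 0)
      ≤ ENNReal.ofReal (t₀ * Real.exp (-(1 / 2))) := by
    calc _ ≤ ∫⁻ t, (Icc 0 t₀).indicator (fun _ ↦ ENNReal.ofReal (Real.exp (-(1 / 2)))) t := by
          rw [← lintegral_indicator measurableSet_Ico]
          refine lintegral_mono fun t ↦ ?_
          by_cases ht : t ∈ Ico 0 ζ
          · rw [indicator_of_mem ht]
            split_ifs with h
            · rw [indicator_of_mem (show t ∈ Icc 0 t₀ from ⟨ht.1, (div_le_one ht₀).1 h⟩)]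
            · simp
          · rw [indicator_of_notMem ht]; exact zero_le
      _ = _ := by
          rw [lintegral_indicator_const measurableSet_Icc, Real.volume_Icc, sub_zero, mul_comm,
            ENNReal.ofReal_mul ht₀.le]
  calc _ ≤ ∫⁻ t in Ico 0 ζ, (ENNReal.ofReal (k t)
        + ENNReal.ofReal (if t / t₀ ≤ 1 then Real.exp (-(1 / 2)) else 0)) :=
        lintegral_mono fun t ↦ by rw [add_comm]; exact ENNReal.ofReal_add_le
    _ ≤ ENNReal.ofReal (t₀ / p) + ENNReal.ofReal (t₀ * Real.exp (-(1 / 2))) := by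
        rw [lintegral_add_left hkc.measurable.ennreal_ofReal]
        exact add_le_add hlint hconst
    _ = _ := by
        rw [← ENNReal.ofReal_add (by positivity) (by positivity)]
        congr 1; ring

/-- The density in `t` of the expected loss `L(a)`. -/
def lossRate (q : ℝ) (μ : Measure ℝ) (a t : ℝ) : ℝ :=
  if t < a then (1 - q) * cdf' μ t else q * (1 - cdf' μ t)

theorem monotone_cdf' (μ : Measure ℝ) [IsProbabilityMeasure μ] : Monotone (cdf' μ) :=
  fun _ _ h ↦ measureReal_mono (Iic_subset_Iic.2 h)

theorem cdf'_nonneg (μ : Measure ℝ) (t : ℝ) : 0 ≤ cdf' μ t := ENNReal.toReal_nonneg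

theorem cdf'_le_one (μ : Measure ℝ) [IsProbabilityMeasure μ] (t : ℝ) : cdf' μ t ≤ 1 :=
  measureReal_le_one

theorem measureReal_Ioi_eq (μ : Measure ℝ) [IsProbabilityMeasure μ] (t : ℝ) :
    μ.real (Ioi t) = 1 - cdf' μ t := by
  rw [← compl_Iic, probReal_compl_eq_one_sub measurableSet_Iic]; rfl

theorem nvLoss_nonneg {q : ℝ} (hq : q ∈ Ioo (0 : ℝ) 1) (a z : ℝ) : 0 ≤ nvLoss q a z :=
  add_nonneg (mul_nonneg hq.1.le (le_max_right _ _))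
    (mul_nonneg (sub_nonneg.2 hq.2.le) (le_max_right _ _))

theorem expLoss_nonneg {q : ℝ} (hq : q ∈ Ioo (0 : ℝ) 1) (μ : Measure ℝ) (a : ℝ) :
    0 ≤ expLoss q μ a :=
  integral_nonneg fun _ ↦ nvLoss_nonneg hq _ _

theorem measurable_lossRate (q : ℝ) (μ : Measure ℝ) [IsProbabilityMeasure μ] (a : ℝ) :
    Measurable (lossRate q μ a) := by
  have := (monotone_cdf' μ).measurable
  unfold lossRate
  exact Measurable.ite measurableSet_Iio (by fun_prop) (by fun_prop)

/-- Layer-cake formula for the expected loss. -/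
theorem ofReal_expLoss_eq_lintegral {q : ℝ} (hq : q ∈ Ioo (0 : ℝ) 1) (μ : Measure ℝ)
    [IsProbabilityMeasure μ] (hmean : Integrable (fun z => z) μ) (a : ℝ) :
    ENNReal.ofReal (expLoss q μ a) = ∫⁻ t, ENNReal.ofReal (lossRate q μ a t) := by
  have hint : Integrable (nvLoss q a) μ := by
    unfold nvLoss
    exact ((hmean.sub (integrable_const a)).pos_part.const_mul q).add
      (((integrable_const a).sub hmean).pos_part.const_mul (1 - q))
  have hpt (z : ℝ) : ENNReal.ofReal (nvLoss q a z)
      = ∫⁻ t, if t < a then (if z ≤ t then ENNReal.ofReal (1 - q) else 0)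
          else (if t < z then ENNReal.ofReal q else 0) := by
    have : (fun t ↦ if t < a then (if z ≤ t then ENNReal.ofReal (1 - q) else 0)
          else (if t < z then ENNReal.ofReal q else 0))
        = fun t ↦ (Ico a z).indicator (fun _ ↦ ENNReal.ofReal q) t
          + (Ico z a).indicator (fun _ ↦ ENNReal.ofReal (1 - q)) t := by
      ext t
      by_cases h1 : t < a <;> by_cases h2 : z ≤ t <;>
        simp [indicator, h1, h2, not_le.2, not_lt.1, not_lt.2, not_le.1]
    rw [this, lintegral_add_left (measurable_const.indicator measurableSet_Ico),
      lintegral_indicator_const measurableSet_Ico, lintegral_indicator_const measurableSet_Ico,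
      Real.volume_Ico, Real.volume_Ico, ← ENNReal.ofReal_mul hq.1.le,
      ← ENNReal.ofReal_mul (sub_nonneg.2 hq.2.le), nvLoss,
      ENNReal.ofReal_add (mul_nonneg hq.1.le (le_max_right _ _))
        (mul_nonneg (sub_nonneg.2 hq.2.le) (le_max_right _ _)),
      ENNReal.ofReal_mul hq.1.le, ENNReal.ofReal_mul (sub_nonneg.2 hq.2.le),
      ENNReal.ofReal_mul hq.1.le, ENNReal.ofReal_mul (sub_nonneg.2 hq.2.le),
      ENNReal.ofReal_max, ENNReal.ofReal_max]
    simp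
  rw [expLoss, ofReal_integral_eq_lintegral_ofReal hint (ae_of_all _ fun z ↦ nvLoss_nonneg hq a z)]
  simp_rw [hpt]
  rw [lintegral_lintegral_swap]
  · refine lintegral_congr fun t ↦ ?_
    unfold lossRate
    split_ifs with h
    · have : (fun z : ℝ ↦ if z ≤ t then ENNReal.ofReal (1 - q) else 0)
          = (Iic t).indicator fun _ ↦ ENNReal.ofReal (1 - q) := by
        ext z; simp [indicator]
      rw [this, lintegral_indicator_const measurableSet_Iic,
        ENNReal.ofReal_mul (sub_nonneg.2 hq.2.le), cdf', ENNReal.ofReal_toReal (measure_ne_top _ _)]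
    · have : (fun z : ℝ ↦ if t < z then ENNReal.ofReal q else 0)
          = (Ioi t).indicator fun _ ↦ ENNReal.ofReal q := by
        ext z; simp [indicator]
      rw [this, lintegral_indicator_const measurableSet_Ioi,
        ENNReal.ofReal_mul hq.1.le, ← measureReal_Ioi_eq, ofReal_measureReal]
  · refine (Measurable.ite (measurableSet_lt measurable_snd measurable_const)
      (Measurable.ite (measurableSet_le measurable_fst measurable_snd) measurable_const
        measurable_const)
      (Measurable.ite (measurableSet_lt measurable_snd measurable_fst) measurable_const
        measurable_const)).aemeasurable

theorem saa_nonneg (q : ℝ) (n : ℕ) (ω : Fin n → ℝ) : 0 ≤ saa q n ω :=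
  Real.sInf_nonneg fun _ h ↦ h.1

theorem optDec_nonneg (q : ℝ) (μ : Measure ℝ) : 0 ≤ optDec q μ :=
  Real.sInf_nonneg fun _ h ↦ h.1

theorem le_cdf'_of_optDec_lt {q : ℝ} (hq : q < 1) (μ : Measure ℝ) [IsProbabilityMeasure μ] {t : ℝ}
    (ht : optDec q μ < t) : q ≤ cdf' μ t := by
  have hne : {a : ℝ | 0 ≤ a ∧ q ≤ cdf' μ a}.Nonempty := by
    have h := (ProbabilityTheory.tendsto_cdf_atTop μ).eventually (lt_mem_nhds hq)
    obtain ⟨a, ha, ha0⟩ := (h.and (Filter.eventually_ge_atTop 0)).exists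
    rw [ProbabilityTheory.cdf_eq_real] at ha
    exact ⟨a, ha0, ha.le⟩
  obtain ⟨b, hb, hbt⟩ := exists_lt_of_csInf_lt hne ht
  exact hb.2.trans (monotone_cdf' μ hbt.le)

theorem cdf'_lt_of_lt_optDec {q : ℝ} {μ : Measure ℝ} {t : ℝ} (h0 : 0 ≤ t)
    (ht : t < optDec q μ) : cdf' μ t < q :=
  not_le.1 fun h ↦ notMem_of_lt_csInf ht ⟨0, fun _ h ↦ h.1⟩ ⟨h0, h⟩

theorem monotone_empCdf (n : ℕ) (ω : Fin n → ℝ) : Monotone (empCdf n ω) := by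
  intro s t h
  unfold empCdf
  gcongr with i
  split_ifs <;> linarith

theorem le_empCdf_of_saa_lt {q : ℝ} (hq : q ≤ 1) {n : ℕ} (hn : 1 ≤ n) {ω : Fin n → ℝ} {t : ℝ}
    (ht : saa q n ω < t) : q ≤ empCdf n ω t := by
  have hne : {a : ℝ | 0 ≤ a ∧ q ≤ empCdf n ω a}.Nonempty := by
    refine ⟨∑ i, |ω i|, Finset.sum_nonneg fun _ _ ↦ abs_nonneg _, ?_⟩
    have h (i : Fin n) : ω i ≤ ∑ j, |ω j| :=
      (le_abs_self _).trans
        (Finset.single_le_sum (f := fun j ↦ |ω j|) (fun _ _ ↦ abs_nonneg _) (Finset.mem_univ i))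
    have hn' : (n : ℝ) ≠ 0 := by positivity
    simpa [empCdf, h, hn'] using hq
  obtain ⟨b, hb, hbt⟩ := exists_lt_of_csInf_lt hne ht
  exact hb.2.trans (monotone_empCdf n ω hbt.le)

theorem empCdf_lt_of_lt_saa {q : ℝ} {n : ℕ} {ω : Fin n → ℝ} {t : ℝ} (h0 : 0 ≤ t)
    (ht : t < saa q n ω) : empCdf n ω t < q :=
  not_le.1 fun h ↦ notMem_of_lt_csInf ht ⟨0, fun _ h ↦ h.1⟩ ⟨h0, h⟩

theorem measurable_empCdf (n : ℕ) :
    Measurable fun x : (Fin n → ℝ) × ℝ ↦ empCdf n x.1 x.2 := by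
  unfold empCdf
  refine (Finset.measurable_sum _ fun i _ ↦ ?_).div_const _
  exact Measurable.ite (measurableSet_le ((measurable_pi_apply i).comp measurable_fst)
    measurable_snd) measurable_const measurable_const

/-- Bound on the density in `t` of the regret of the SAA decision for the samples `ω`. -/
def regretRate (q : ℝ) (μ : Measure ℝ) (n : ℕ) (ω : Fin n → ℝ) (t : ℝ) : ENNReal :=
  if t < optDec q μ then
    (if 0 ≤ t ∧ q ≤ empCdf n ω t then ENNReal.ofReal (q - cdf' μ t) else 0)
  else (if empCdf n ω t < q then ENNReal.ofReal (cdf' μ t - q) else 0)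

theorem measurable_regretRate (q : ℝ) (μ : Measure ℝ) [IsProbabilityMeasure μ] (n : ℕ) :
    Measurable fun x : (Fin n → ℝ) × ℝ ↦ regretRate q μ n x.1 x.2 := by
  have hF := (monotone_cdf' μ).measurable
  have hE := measurable_empCdf n
  unfold regretRate
  refine Measurable.ite (measurableSet_lt measurable_snd measurable_const)
    (Measurable.ite ?_ ?_ measurable_const)
    (Measurable.ite (measurableSet_lt hE measurable_const) ?_ measurable_const)
  · exact (measurableSet_le measurable_const measurable_snd).inter
      (measurableSet_le measurable_const hE)
  · exact ((hF.comp measurable_snd).const_sub q).ennreal_ofReal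
  · exact ((hF.comp measurable_snd).sub_const q).ennreal_ofReal

theorem ofReal_lossRate_saa_le {q : ℝ} (hq : q ∈ Ioo (0 : ℝ) 1) (μ : Measure ℝ)
    {n : ℕ} (hn : 1 ≤ n) (ω : Fin n → ℝ) {t : ℝ} (ht : t ≠ saa q n ω) :
    ENNReal.ofReal (lossRate q μ (saa q n ω) t)
      ≤ ENNReal.ofReal (lossRate q μ (optDec q μ) t) + regretRate q μ n ω t := by
  have ha := saa_nonneg q n ω
  have ha' := optDec_nonneg q μ
  unfold regretRate lossRate
  rcases ht.lt_or_gt with h | h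
  · by_cases h' : t < optDec q μ
    · simp [h, h']
    · have h0 : 0 ≤ t := ha'.trans (not_lt.1 h')
      rw [if_pos h, if_neg h', if_neg h', if_pos (empCdf_lt_of_lt_saa h0 h)]
      refine le_trans (ENNReal.ofReal_le_ofReal ?_) ENNReal.ofReal_add_le
      linarith
  · by_cases h' : t < optDec q μ
    · have h0 : 0 ≤ t := ha.trans h.le
      rw [if_neg h.not_gt, if_pos h', if_pos h', if_pos ⟨h0, le_empCdf_of_saa_lt hq.2.le hn h⟩]
      refine le_trans (ENNReal.ofReal_le_ofReal ?_) ENNReal.ofReal_add_le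
      linarith
    · simp [h.not_gt, h']

theorem lintegral_ofReal_expLoss_saa_le {q : ℝ} (hq : q ∈ Ioo (0 : ℝ) 1) (μ : Measure ℝ)
    [IsProbabilityMeasure μ] (hmean : Integrable (fun z => z) μ) {n : ℕ} (hn : 1 ≤ n) :
    ∫⁻ ω, ENNReal.ofReal (expLoss q μ (saa q n ω)) ∂(iid μ n)
      ≤ ENNReal.ofReal (expLoss q μ (optDec q μ))
        + ∫⁻ t, ∫⁻ ω, regretRate q μ n ω t ∂(iid μ n) := by
  have hprob : IsProbabilityMeasure (iid μ n) := by unfold iid; infer_instance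
  calc _ ≤ ∫⁻ ω, (ENNReal.ofReal (expLoss q μ (optDec q μ))
        + ∫⁻ t, regretRate q μ n ω t) ∂(iid μ n) := by
        refine lintegral_mono fun ω ↦ ?_
        rw [ofReal_expLoss_eq_lintegral hq μ hmean, ofReal_expLoss_eq_lintegral hq μ hmean,
          ← lintegral_add_left (measurable_lossRate q μ _).ennreal_ofReal]
        refine lintegral_mono_ae ?_
        filter_upwards [Measure.ae_ne volume (saa q n ω)] with t ht
        exact ofReal_lossRate_saa_le hq μ hn ω ht
    _ = _ := by
        rw [lintegral_add_left measurable_const, lintegral_const, measure_univ, mul_one,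
          lintegral_lintegral_swap (measurable_regretRate q μ n).aemeasurable]

/-- The expected regret density is controlled by a tail probability of a sample count. -/
theorem lintegral_regretRate_le (q : ℝ) (μ : Measure ℝ) [IsProbabilityMeasure μ]
    {n : ℕ} (hn : 1 ≤ n) (t : ℝ)
    {x C : ℝ} (hx : x = |cdf' μ t - q|)
    (hC : ∀ (A : Set ℝ) (r : ℝ), MeasurableSet A → 0 < x → r - μ.real A = x →
      μ.real A * (1 - μ.real A) = cdf' μ t * (1 - cdf' μ t) →
      x * (iid μ n).real {ω | n * r ≤ ∑ i, A.indicator 1 (ω i)} ≤ C) :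
    ∫⁻ ω, regretRate q μ n ω t ∂(iid μ n) ≤ ENNReal.ofReal C := by
  have hprob : IsProbabilityMeasure (iid μ n) := by unfold iid; infer_instance
  have hn' : (0 : ℝ) < n := by positivity
  have key (s : Set (Fin n → ℝ)) (A : Set ℝ) (r : ℝ) (hA : MeasurableSet A) (hx0 : 0 < x)
      (hr : r - μ.real A = x) (hv : μ.real A * (1 - μ.real A) = cdf' μ t * (1 - cdf' μ t))
      (hs : s ⊆ {ω | n * r ≤ ∑ i, A.indicator 1 (ω i)}) :
      ∫⁻ ω, s.indicator (fun _ ↦ ENNReal.ofReal x) ω ∂(iid μ n) ≤ ENNReal.ofReal C := by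
    refine (lintegral_indicator_const_le _ _).trans ?_
    refine (mul_le_mul_right (measure_mono hs) _).trans ?_
    rw [← ofReal_measureReal, ← ENNReal.ofReal_mul hx0.le]
    exact ENNReal.ofReal_le_ofReal (hC A r hA hx0 hr hv)
  unfold regretRate
  by_cases ht : t < optDec q μ
  · simp only [if_pos ht]
    by_cases h : 0 ≤ t
    · have hF := cdf'_lt_of_lt_optDec h ht
      have hxe : x = q - cdf' μ t := by rw [hx, abs_of_neg (sub_neg.2 hF)]; ring
      convert! key {ω | q ≤ empCdf n ω t} (Iic t) q measurableSet_Iic (by linarith) hxe.symm rfl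
        ?_ using 2
      · ext ω; simp [indicator, h, hxe]
      · intro ω hω
        rw [mem_ofPred_eq, empCdf, le_div_iff₀ hn'] at hω
        rw [mem_ofPred_eq, mul_comm]
        simpa [indicator] using hω
    · simp [h]
  · simp only [if_neg ht]
    by_cases h : cdf' μ t ≤ q
    · simp [ENNReal.ofReal_of_nonpos (sub_nonpos.2 h)]
    · rw [not_le] at h
      have hxe : x = cdf' μ t - q := by rw [hx, abs_of_pos (sub_pos.2 h)]
      convert! key {ω | empCdf n ω t < q} (Ioi t) (1 - q) measurableSet_Ioi (by linarith)
        (by rw [measureReal_Ioi_eq, hxe]; ring) (by rw [measureReal_Ioi_eq]; ring) ?_ using 2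
      · ext ω; simp [indicator, hxe]
      · intro ω hω
        rw [mem_ofPred_eq, empCdf, div_lt_iff₀ hn'] at hω
        rw [mem_ofPred_eq]
        have : ∑ i, (Ioi t).indicator (1 : ℝ → ℝ) (ω i)
            = n - ∑ i, if ω i ≤ t then (1 : ℝ) else 0 := by
          rw [eq_sub_iff_add_eq, ← Finset.sum_add_distrib]
          trans ∑ i : Fin n, (1 : ℝ)
          · refine Finset.sum_congr rfl fun i _ ↦ ?_
            by_cases hi : ω i ≤ t <;> simp [indicator, hi, not_lt.2, not_le.1]
          · simp
        rw [this]
        linarith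

theorem Clustered.rpow_le {q β γ ζ : ℝ} {μ : Measure ℝ} (h : Clustered q β γ ζ μ) (hβ : 0 ≤ β)
    (hγ : 0 < γ) {t : ℝ} (ht : |t - optDec q μ| ≤ ζ) :
    (γ * |t - optDec q μ|) ^ (β + 1) ≤ |cdf' μ t - q| := by
  rw [abs_le] at ht
  have h1 := h t ⟨by linarith, by linarith⟩
  rw [one_div_mul_eq_div, le_div_iff₀ hγ, mul_comm] at h1
  calc _ ≤ (|cdf' μ t - q| ^ ((1 : ℝ) / (β + 1))) ^ (β + 1) := by gcongr
    _ = _ := by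
      rw [← Real.rpow_mul (abs_nonneg _), one_div_mul_cancel (by positivity), Real.rpow_one]

/-- Hoeffding bound on the total expected regret density at distance less than `ζ`
from the optimal decision. -/
theorem setLIntegral_regretRate_near_le {q β γ ζ : ℝ} (hβ : 0 ≤ β) (hγ : 0 < γ) (hζ : 0 < ζ)
    (μ : Measure ℝ) [IsProbabilityMeasure μ] (hclus : Clustered q β γ ζ μ) {n : ℕ} (hn : 1 ≤ n) :
    ∫⁻ t in Ioo (optDec q μ - ζ) (optDec q μ + ζ), ∫⁻ ω, regretRate q μ n ω t ∂(iid μ n)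
      ≤ ENNReal.ofReal (2 / γ * (1 / (β + 1) + Real.exp (-(1 / 2)))
        * (1 / (2 * Real.sqrt n)) ^ ((β + 2) / (β + 1))) := by
  have hp : 1 ≤ β + 1 := by linarith
  have hn' : (0 : ℝ) < n := by positivity
  set a := optDec q μ
  set p := β + 1 with hpdef
  set x₀ : ℝ := 1 / (2 * Real.sqrt n) with hx₀
  have hx₀pos : 0 < x₀ := by positivity
  have hnx₀ : 2 * n * x₀ ^ 2 = 1 / 2 := by
    rw [hx₀, div_pow, mul_pow, Real.sq_sqrt hn'.le]; field_simp
  set t₀ : ℝ := x₀ ^ (1 / p) / γ with ht₀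
  have ht₀pos : 0 < t₀ := by positivity
  have ht₀p : (γ * t₀) ^ p = x₀ := by
    rw [ht₀, mul_div_cancel₀ _ hγ.ne', ← Real.rpow_mul hx₀pos.le,
      one_div_mul_cancel (by positivity), Real.rpow_one]
  set f : ℝ → ℝ := fun t ↦ (if t / t₀ ≤ 1 then Real.exp (-(1 / 2)) else 0)
    + (t / t₀) ^ (2 * p - 1) * Real.exp (-((t / t₀) ^ (2 * p) / 2)) with hf
  have hfm : Measurable f :=
    (Measurable.ite (measurableSet_le (by fun_prop) measurable_const) measurable_const
      measurable_const).add (by fun_prop)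
  set g : ℝ → ENNReal := (Ico 0 ζ).indicator fun t ↦ ENNReal.ofReal (f t) with hg
  have hgm : Measurable g := hfm.ennreal_ofReal.indicator measurableSet_Ico
  have hgint : ∫⁻ t, g t ≤ ENNReal.ofReal (t₀ * (1 / p + Real.exp (-(1 / 2)))) := by
    rw [hg, lintegral_indicator measurableSet_Ico]
    exact lintegral_mul_exp_neg_rpow_le hp ht₀pos hζ
  have hpt (t : ℝ) (ht : |t - a| < ζ) :
      ∫⁻ ω, regretRate q μ n ω t ∂(iid μ n) ≤ ENNReal.ofReal (x₀ * f |t - a|) := by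
    refine lintegral_regretRate_le q μ hn t rfl fun A r hA hx hr _ ↦ ?_
    set x := |cdf' μ t - q|
    have hH := iid_count_ge_le_exp μ hn hA (r := r) (by linarith)
    rw [hr] at hH
    refine (mul_le_mul_of_nonneg_left hH hx.le).trans ?_
    have hw : (|t - a| / t₀) ^ p ≤ x / x₀ := by
      rw [← ht₀p, ← mul_div_mul_left _ _ hγ.ne', Real.div_rpow (by positivity) (by positivity)]
      gcongr
      exact hclus.rpow_le hβ hγ ht.le
    refine le_trans (le_of_eq ?_) (mul_le_mul_of_nonneg_left
      (mul_exp_neg_sq_le_of_rpow_le hp (by positivity) hw) hx₀pos.le)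
    rw [← mul_assoc, mul_div_cancel₀ _ hx₀pos.ne']
    congr 2
    rw [div_pow, div_div, eq_comm, neg_mul, neg_mul, neg_inj, div_eq_iff (by positivity)]
    linear_combination (-(2 * x ^ 2)) * hnx₀
  calc _ ≤ ∫⁻ t in Ioo (a - ζ) (a + ζ), ENNReal.ofReal x₀ * (g (t - a) + g (a - t)) := by
        refine setLIntegral_mono' measurableSet_Ioo fun t ht ↦ ?_
        have hta : |t - a| < ζ := abs_lt.2 ⟨by linarith [ht.1], by linarith [ht.2]⟩
        refine (hpt t hta).trans ?_
        rw [ENNReal.ofReal_mul hx₀pos.le]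
        gcongr
        rcases le_total a t with h | h
        · rw [abs_of_nonneg (sub_nonneg.2 h)] at hta ⊢
          refine le_add_right ?_
          rw [hg, indicator_of_mem (show t - a ∈ Ico 0 ζ from ⟨sub_nonneg.2 h, hta⟩)]
        · rw [abs_of_nonpos (sub_nonpos.2 h), neg_sub] at hta ⊢
          refine le_add_left ?_
          rw [hg, indicator_of_mem (show a - t ∈ Ico 0 ζ from ⟨sub_nonneg.2 h, hta⟩)]
    _ ≤ ∫⁻ t, ENNReal.ofReal x₀ * (g (t - a) + g (a - t)) := setLIntegral_le_lintegral _ _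
    _ = ENNReal.ofReal x₀ * ((∫⁻ t, g t) + ∫⁻ t, g t) := by
        rw [lintegral_const_mul' _ _ ENNReal.ofReal_ne_top, lintegral_add_left (by fun_prop),
          lintegral_sub_right_eq_self, lintegral_sub_left_eq_self]
    _ ≤ ENNReal.ofReal x₀ * (ENNReal.ofReal (t₀ * (1 / p + Real.exp (-(1 / 2))))
        + ENNReal.ofReal (t₀ * (1 / p + Real.exp (-(1 / 2))))) := by gcongr
    _ = _ := by
        rw [← ENNReal.ofReal_add (by positivity) (by positivity),
          ← ENNReal.ofReal_mul hx₀pos.le]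
        congr 1
        have : x₀ ^ ((β + 2) / p) = x₀ * x₀ ^ (1 / p) := by
          rw [← Real.rpow_one_add' hx₀pos.le (by positivity)]
          congr 1
          rw [hpdef]; field_simp; ring
        rw [this, ht₀]
        ring

/-- Chebyshev bound on the expected regret density where the distribution function differs
from `q` by at least `d`. -/
theorem lintegral_regretRate_le_mul_lossRate {q d : ℝ} (hq : q ∈ Ioo (0 : ℝ) 1) (hd : 0 < d)
    (μ : Measure ℝ) [IsProbabilityMeasure μ] {n : ℕ} (hn : 1 ≤ n) {t : ℝ}
    (ht : d ≤ |cdf' μ t - q|) :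
    ∫⁻ ω, regretRate q μ n ω t ∂(iid μ n) ≤ ENNReal.ofReal (1 / (n * d * min q (1 - q)))
      * ENNReal.ofReal (lossRate q μ (optDec q μ) t) := by
  have hn' : (0 : ℝ) < n := by positivity
  have hm : 0 < min q (1 - q) := lt_min hq.1 (sub_pos.2 hq.2)
  have hF0 := cdf'_nonneg μ t
  have hF1 := cdf'_le_one μ t
  rw [← ENNReal.ofReal_mul (by positivity)]
  refine lintegral_regretRate_le q μ hn t rfl fun A r hA hx hr hv ↦ ?_
  set x := |cdf' μ t - q|
  have hH := iid_count_ge_le_variance μ hn hA (r := r) (by linarith)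
  rw [hr, hv] at hH
  have hl : cdf' μ t * (1 - cdf' μ t) * min q (1 - q) ≤ lossRate q μ (optDec q μ) t := by
    unfold lossRate
    split_ifs
    · calc _ ≤ cdf' μ t * 1 * (1 - q) := by
            gcongr
            · linarith
            · exact min_le_right _ _
        _ = _ := by ring
    · calc _ ≤ 1 * (1 - cdf' μ t) * q := by
            gcongr
            · exact min_le_left _ _
        _ = _ := by ring
  have hvar : 0 ≤ cdf' μ t * (1 - cdf' μ t) := mul_nonneg hF0 (sub_nonneg.2 hF1)
  calc _ ≤ x * (cdf' μ t * (1 - cdf' μ t) / (n * x ^ 2)) := by gcongr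
    _ = cdf' μ t * (1 - cdf' μ t) / (n * x) := by field_simp
    _ ≤ cdf' μ t * (1 - cdf' μ t) / (n * d) := by gcongr
    _ = 1 / (n * d * min q (1 - q)) * (cdf' μ t * (1 - cdf' μ t) * min q (1 - q)) := by
        field_simp
    _ ≤ _ := by gcongr

theorem Clustered.rpow_le_of_le_abs {q β γ ζ : ℝ} (hq : q < 1) (hβ : 0 ≤ β) (hγ : 0 < γ)
    (hζ : 0 < ζ) {μ : Measure ℝ} [IsProbabilityMeasure μ] (h : Clustered q β γ ζ μ)
    (ha : 0 ≤ optDec q μ - ζ) {t : ℝ}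
    (ht : t ∉ Ioo (optDec q μ - ζ) (optDec q μ + ζ)) :
    (γ * ζ) ^ (β + 1) ≤ |cdf' μ t - q| := by
  rw [mem_Ioo, not_and_or, not_lt, not_lt] at ht
  rcases ht with ht | ht
  · have h1 := h.rpow_le hβ hγ (t := optDec q μ - ζ) (by simp [abs_of_pos hζ])
    have h2 : cdf' μ (optDec q μ - ζ) < q := cdf'_lt_of_lt_optDec ha (by linarith)
    have h3 := monotone_cdf' μ ht
    rw [sub_sub_cancel_left, abs_neg, abs_of_pos hζ, abs_of_neg (by linarith)] at h1
    rw [abs_of_neg (by linarith)]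
    linarith
  · have h1 := h.rpow_le hβ hγ (t := optDec q μ + ζ) (by simp [abs_of_pos hζ])
    have h2 : q ≤ cdf' μ (optDec q μ + ζ) := le_cdf'_of_optDec_lt hq μ (by linarith)
    have h3 := monotone_cdf' μ ht
    rw [add_sub_cancel_left, abs_of_pos hζ, abs_of_nonneg (by linarith)] at h1
    rw [abs_of_nonneg (by linarith)]
    linarith

theorem le_setLIntegral_lossRate {q ζ τ : ℝ} (hq : q ∈ Ioo (0 : ℝ) 1) (hζ : 0 < ζ) (hτ : 0 ≤ τ)
    (μ : Measure ℝ) [IsProbabilityMeasure μ] (hlo : τ ≤ cdf' μ (optDec q μ - ζ))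
    (hhi : cdf' μ (optDec q μ + ζ) ≤ 1 - τ) :
    ENNReal.ofReal (ζ * τ) ≤ ∫⁻ t in Ioo (optDec q μ - ζ) (optDec q μ + ζ),
      ENNReal.ofReal (lossRate q μ (optDec q μ) t) := by
  set a := optDec q μ
  have h1q : 0 ≤ 1 - q := sub_nonneg.2 hq.2.le
  calc ENNReal.ofReal (ζ * τ)
      = ENNReal.ofReal ((1 - q) * τ) * volume (Ioo (a - ζ) a)
        + ENNReal.ofReal (q * τ) * volume (Ico a (a + ζ)) := by
        rw [Real.volume_Ioo, Real.volume_Ico, ← ENNReal.ofReal_mul (mul_nonneg h1q hτ),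
          ← ENNReal.ofReal_mul (mul_nonneg hq.1.le hτ), ← ENNReal.ofReal_add]
        · congr 1; ring
        · exact mul_nonneg (mul_nonneg h1q hτ) (by linarith)
        · exact mul_nonneg (mul_nonneg hq.1.le hτ) (by linarith)
    _ ≤ (∫⁻ t in Ioo (a - ζ) a, ENNReal.ofReal (lossRate q μ a t))
        + ∫⁻ t in Ico a (a + ζ), ENNReal.ofReal (lossRate q μ a t) := by
        rw [← setLIntegral_const, ← setLIntegral_const]
        refine add_le_add (setLIntegral_mono' measurableSet_Ioo fun t ht ↦ ?_)
          (setLIntegral_mono' measurableSet_Ico fun t ht ↦ ?_) <;>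
          refine ENNReal.ofReal_le_ofReal ?_ <;> unfold lossRate
        · rw [if_pos ht.2]
          exact mul_le_mul_of_nonneg_left (hlo.trans (monotone_cdf' μ ht.1.le)) h1q
        · rw [if_neg ht.1.not_gt]
          exact mul_le_mul_of_nonneg_left (by linarith [monotone_cdf' μ ht.2.le]) hq.1.le
    _ = _ := by
        rw [← lintegral_union measurableSet_Ico, Ioo_union_Ico_eq_Ioo (by linarith) (by linarith)]
        exact disjoint_left.2 fun t h1 h2 ↦ h1.2.not_ge h2.1

/-- Expected multiplicative regret upper bound for SAA on `(β,γ,ζ)`-clustered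
distributions with `F(a*−ζ) ≥ τ` and `F(a*+ζ) ≤ 1−τ`: for every `n ≥ 1`,
`(E[L(â)] − L(a*))/L(a*) ≤ max{1/(n(γζ)^{β+1}·min{q,1−q}),
  (2/(γζτ))·(1/(β+1)+1/√e)·(1/(2√n))^{(β+2)/(β+1)}}`. -/
theorem saa_expected_multiplicative_regret_clustered
    (q β γ ζ τ : ℝ) (hq : q ∈ Ioo (0:ℝ) 1) (hβ : 0 ≤ β) (hγ : 0 < γ)
    (hζ : ζ ∈ Ioo 0 ((min q (1 - q)) ^ ((1:ℝ)/(β+1)) / γ))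
    (hτ : τ ∈ Ioc 0 (min q (1 - q) - (γ*ζ) ^ (β+1)))
    (μ : Measure ℝ) [IsProbabilityMeasure μ] (hsupp : μ (Iio 0) = 0)
    (hmean : Integrable (fun z => z) μ)
    (hclus : Clustered q β γ ζ μ)
    (hlo : τ ≤ cdf' μ (optDec q μ - ζ)) (hhi : cdf' μ (optDec q μ + ζ) ≤ 1 - τ)
    (n : ℕ) (hn : 1 ≤ n) :
    ((∫ ω, expLoss q μ (saa q n ω) ∂(iid μ n)) - expLoss q μ (optDec q μ))
        / expLoss q μ (optDec q μ)
      ≤ max (1 / (n * (γ*ζ) ^ (β+1) * min q (1 - q)))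
            ((2/(γ*ζ*τ)) * (1/(β+1) + 1/Real.sqrt (Real.exp 1))
              * (1/(2*Real.sqrt n)) ^ ((β+2)/(β+1))) := by
  have hζ0 := hζ.1
  have hτ0 := hτ.1
  have hm : 0 < min q (1 - q) := lt_min hq.1 (sub_pos.2 hq.2)
  have hn' : (0 : ℝ) < n := by positivity
  have ha : 0 ≤ optDec q μ - ζ := by
    by_contra! h
    have h0 : cdf' μ (optDec q μ - ζ) = 0 := by
      rw [cdf', measure_mono_null (Iic_subset_Iio.2 h) hsupp, ENNReal.toReal_zero]
    linarith
  set K : ℝ := 1 / (n * (γ*ζ) ^ (β+1) * min q (1 - q))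
  set B : ℝ := (2/(γ*ζ*τ)) * (1/(β+1) + 1/Real.sqrt (Real.exp 1))
    * (1/(2*Real.sqrt n)) ^ ((β+2)/(β+1)) with hB
  have hM : 0 ≤ max K B := le_max_of_le_right (by positivity)
  have hL0 := expLoss_nonneg hq μ (optDec q μ)
  set S := Ioo (optDec q μ - ζ) (optDec q μ + ζ)
  have hnear : ∫⁻ t in S, ∫⁻ ω, regretRate q μ n ω t ∂(iid μ n)
      ≤ ENNReal.ofReal (max K B)
        * ∫⁻ t in S, ENNReal.ofReal (lossRate q μ (optDec q μ) t) := by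
    refine (setLIntegral_regretRate_near_le hβ hγ hζ0 μ hclus hn).trans ?_
    refine le_trans ?_ (mul_le_mul' (ENNReal.ofReal_le_ofReal (le_max_right K B))
      (le_setLIntegral_lossRate hq hζ0 hτ0.le μ hlo hhi))
    rw [← ENNReal.ofReal_mul (by positivity)]
    refine ENNReal.ofReal_le_ofReal (le_of_eq ?_)
    have he : Real.exp (-(1 / 2)) = 1 / Real.sqrt (Real.exp 1) := by
      rw [Real.exp_neg, Real.exp_half, one_div]
    rw [he, hB]
    field_simp
  have hfar : ∫⁻ t in Sᶜ, ∫⁻ ω, regretRate q μ n ω t ∂(iid μ n)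
      ≤ ENNReal.ofReal (max K B)
        * ∫⁻ t in Sᶜ, ENNReal.ofReal (lossRate q μ (optDec q μ) t) := by
    rw [← lintegral_const_mul' _ _ ENNReal.ofReal_ne_top]
    refine setLIntegral_mono' measurableSet_Ioo.compl fun t ht ↦ ?_
    refine (lintegral_regretRate_le_mul_lossRate hq (by positivity) μ hn
      (hclus.rpow_le_of_le_abs hq.2 hβ hγ hζ0 ha ht)).trans ?_
    gcongr
    exact le_max_left K B
  have htotal : ∫⁻ ω, ENNReal.ofReal (expLoss q μ (saa q n ω)) ∂(iid μ n)
      ≤ ENNReal.ofReal ((1 + max K B) * expLoss q μ (optDec q μ)) := by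
    refine (lintegral_ofReal_expLoss_saa_le hq μ hmean hn).trans ?_
    rw [add_mul, one_mul, ENNReal.ofReal_add hL0 (mul_nonneg hM hL0), ENNReal.ofReal_mul hM]
    refine add_le_add le_rfl ?_
    rw [ofReal_expLoss_eq_lintegral hq μ hmean, ← lintegral_add_compl _ measurableSet_Ioo,
      ← lintegral_add_compl (fun t ↦ ENNReal.ofReal (lossRate q μ (optDec q μ) t))
        measurableSet_Ioo, mul_add]
    exact add_le_add hnear hfar
  have hint : ∫ ω, expLoss q μ (saa q n ω) ∂(iid μ n)
      ≤ (1 + max K B) * expLoss q μ (optDec q μ) := by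
    have hR : 0 ≤ (1 + max K B) * expLoss q μ (optDec q μ) := by positivity
    by_cases h : Integrable (fun ω ↦ expLoss q μ (saa q n ω)) (iid μ n)
    · rw [integral_eq_lintegral_of_nonneg_ae (ae_of_all _ fun ω ↦ expLoss_nonneg hq μ _) h.1]
      exact ENNReal.toReal_le_of_le_ofReal hR htotal
    · rw [integral_undef h]; exact hR
  rcases hL0.eq_or_lt with h | h
  · rw [← h, div_zero]; exact hM
  · rw [div_le_iff₀ h]; linarith
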